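/- Let p₀ ∈ (0,1), μ ∈ ℝ, σ > 0, and let γ ≠ 0 satisfy g(γ) > p₀ if γ > 0 and g(γ) > 1 − p₀ if γ < 0, where g(γ) = 2Φ(−|γ|)·exp(γ²/2). Let f_{p₀} be the quantile-fixed GAL density with parameters (μ, σ, γ). Then for every y ∈ ℝ, with y* = (y−μ)/σ, ∫_{−∞}^y f_{p₀}(v) dv = ( 1 − 2Φ(y*·p_{γ+}/γ) + 2p_{γ+}·exp(−y*·p_{γ−} + (γ²/2)(p_{γ−}/p_{γ+})²)·[ Φ(−y*·p_{γ+}/|γ| + (p_{γ−}/p_{γ+})·|γ|) − Φ((p_{γ−}/p_{γ+})·|γ|) ] )·1{y*/γ > 0} + 1{γ < 0} + 2p_{γ−}·exp(−y*·p_{γ+} + γ²/2)·Φ( −|γ| + (y*·p_{γ+}/|γ|)·1{y*/γ > 0} ). -/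

import Mathlib

open MeasureTheory Real Set

/-- Standard normal CDF. -/
noncomputable def Phi (x : ℝ) : ℝ :=
  ∫ t in Set.Iic x, (Real.sqrt (2 * Real.pi))⁻¹ * Real.exp (-t ^ 2 / 2)

/-- The function g(γ) = 2Φ(−|γ|)exp(γ²/2). -/
noncomputable def gFun (γ : ℝ) : ℝ := 2 * Phi (-|γ|) * Real.exp (γ ^ 2 / 2)

/-- The quantile-fixed GAL density with quantile p₀ and parameters (μ, σ, γ). -/
noncomputable def galQPdf (p₀ μ σ γ y : ℝ) : ℝ :=
  let p := (if γ < 0 then 1 else 0) + (p₀ - (if γ < 0 then 1 else 0)) / gFun γ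
  let pP := p - (if 0 < γ then 1 else 0)
  let pM := p - (if γ < 0 then 1 else 0)
  let ys := (y - μ) / σ
  (2 * p * (1 - p) / σ) *
    ((Phi (-(ys * pP / |γ|) + pM / pP * |γ|) - Phi (pM / pP * |γ|)) *
        Real.exp (-(ys * pM) + γ ^ 2 / 2 * (pM / pP) ^ 2) *
        (if 0 < ys / γ then 1 else 0) +
      Phi (-|γ| + ys * pP / |γ| * (if 0 < ys / γ then 1 else 0)) *
        Real.exp (-(ys * pP) + γ ^ 2 / 2))

open Filter Topology ProbabilityTheory

lemma Phi_eq_setIntegral_gaussianPDFReal (x : ℝ) :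
    Phi x = ∫ t in Iic x, gaussianPDFReal 0 1 t := by
  simp [Phi, gaussianPDFReal]

lemma Phi_eq_measureReal_gaussianReal (x : ℝ) : Phi x = (gaussianReal 0 1).real (Iic x) := by
  rw [Phi_eq_setIntegral_gaussianPDFReal, measureReal_def,
    gaussianReal_apply_eq_integral 0 one_ne_zero, ENNReal.toReal_ofReal]
  exact integral_nonneg (gaussianPDFReal_nonneg 0 1)

lemma Phi_eq_cdf (x : ℝ) : Phi x = cdf (gaussianReal 0 1) x := by
  rw [Phi_eq_measureReal_gaussianReal, cdf_eq_real]

lemma Phi_nonneg (x : ℝ) : 0 ≤ Phi x := by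
  rw [Phi_eq_cdf]; exact cdf_nonneg _ _

lemma Phi_le_one (x : ℝ) : Phi x ≤ 1 := by
  rw [Phi_eq_cdf]; exact cdf_le_one _ _

lemma Phi_mono : Monotone Phi := by
  intro x y h
  rw [Phi_eq_cdf, Phi_eq_cdf]
  exact monotone_cdf _ h

lemma tendsto_Phi_atTop : Tendsto Phi atTop (𝓝 1) :=
  (tendsto_cdf_atTop (gaussianReal 0 1)).congr fun x => (Phi_eq_cdf x).symm

lemma continuous_gaussianPDFReal (m : ℝ) (v : NNReal) : Continuous (gaussianPDFReal m v) := by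
  unfold gaussianPDFReal
  fun_prop

lemma hasDerivAt_Phi (x : ℝ) : HasDerivAt Phi (gaussianPDFReal 0 1 x) x := by
  have hintegrable (s : Set ℝ) : IntegrableOn (gaussianPDFReal 0 1) s :=
    (integrable_gaussianPDFReal 0 1).integrableOn
  have hPhi : Phi = fun y => Phi 0 + ∫ t in (0 : ℝ)..y, gaussianPDFReal 0 1 t := by
    ext y
    rw [← intervalIntegral.integral_Iic_sub_Iic (hintegrable _) (hintegrable _),
      Phi_eq_setIntegral_gaussianPDFReal, Phi_eq_setIntegral_gaussianPDFReal]
    ring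
  rw [hPhi]
  exact ((continuous_gaussianPDFReal 0 1).integral_hasStrictDerivAt 0 x).hasDerivAt.const_add _

lemma Phi_add_Phi_neg (x : ℝ) : Phi x + Phi (-x) = 1 := by
  have hneg : Phi (-x) = ∫ t in Ioi x, gaussianPDFReal 0 1 t := by
    rw [Phi_eq_setIntegral_gaussianPDFReal, ← neg_neg x, ← integral_comp_neg_Iic, neg_neg]
    simp [gaussianPDFReal]
  rw [hneg, Phi_eq_setIntegral_gaussianPDFReal, ← integral_gaussianPDFReal_eq_one 0 one_ne_zero,
    ← compl_Iic]
  exact integral_add_compl measurableSet_Iic (integrable_gaussianPDFReal 0 1)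

lemma Phi_zero : Phi 0 = 1 / 2 := by
  have h := Phi_add_Phi_neg 0
  rw [neg_zero] at h
  linarith

/-- Chernoff bound for the lower tail of the standard normal distribution. -/
lemma Phi_le_exp (x : ℝ) {c : ℝ} (hc : 0 ≤ c) : Phi x ≤ exp (c * x + c ^ 2 / 2) := by
  have h := measure_le_le_exp_mul_mgf (μ := gaussianReal 0 1) (X := id) (t := -c) x
    (by linarith) (integrable_exp_mul_gaussianReal (-c))
  rw [mgf_id_gaussianReal, ← exp_add] at h
  rw [Phi_eq_measureReal_gaussianReal]
  refine h.trans_eq ?_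
  simp

lemma tendsto_exp_mul_Phi_atBot (c : ℝ) :
    Tendsto (fun x => exp (-(c * x)) * Phi x) atBot (𝓝 0) := by
  have hbound : Tendsto (fun x => exp ((|c| + 1) ^ 2 / 2) * exp x) atBot (𝓝 0) := by
    simpa using tendsto_exp_atBot.const_mul (exp ((|c| + 1) ^ 2 / 2))
  refine squeeze_zero' (Eventually.of_forall fun x => by have := Phi_nonneg x; positivity) ?_ hbound
  filter_upwards [eventually_le_atBot 0] with x hx
  calc exp (-(c * x)) * Phi x
      ≤ exp (-(c * x)) * exp ((|c| + 1) * x + (|c| + 1) ^ 2 / 2) := by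
        gcongr
        exact Phi_le_exp x (by positivity)
    _ ≤ exp ((|c| + 1) ^ 2 / 2) * exp x := by
        rw [← exp_add, ← exp_add, exp_le_exp]
        nlinarith [neg_abs_le c, le_abs_self c]

/-- An antiderivative of a nonnegative function that vanishes at `-∞` is its integral over
`Iic y`. -/
lemma integral_Iic_of_hasDerivAt_of_nonneg {F f : ℝ → ℝ} (hderiv : ∀ x, HasDerivAt F (f x) x)
    (hf : ∀ x, 0 ≤ f x) (hF : Tendsto F atBot (𝓝 0)) (y : ℝ) : ∫ x in Iic y, f x = F y := by
  have hreflect : ∫ x in Iic y, f x = ∫ x in Ioi (-y), f (-x) := by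
    rw [← integral_comp_neg_Iic]
    simp
  have hderiv' (x : ℝ) : HasDerivAt (fun x => -F (-x)) (f (-x)) x := by
    simpa [Function.comp_def] using! ((hderiv (-x)).comp x (hasDerivAt_neg x)).neg
  have hlim : Tendsto (fun x => -F (-x)) atTop (𝓝 0) := by
    simpa using (hF.comp tendsto_neg_atTop_atBot).neg
  rw [hreflect, integral_Ioi_of_hasDerivAt_of_nonneg' (fun x _ => hderiv' x) (fun x _ => hf _) hlim]
  simp

lemma hasDerivAt_ite_div_pos {γ : ℝ} (hγ : γ ≠ 0) {F G f g : ℝ → ℝ}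
    (hF : ∀ x, HasDerivAt F (f x) x) (hG : ∀ x, HasDerivAt G (g x) x)
    (hFG : F 0 = G 0) (hfg : f 0 = g 0) (x : ℝ) :
    HasDerivAt (fun x => if 0 < x / γ then F x else G x) (if 0 < x / γ then f x else g x) x := by
  have hcont : Continuous fun x : ℝ => x / γ := by fun_prop
  rcases lt_trichotomy (x / γ) 0 with hx | hx | hx
  · rw [if_neg hx.not_gt]
    refine (hG x).congr_of_eventuallyEq ?_
    filter_upwards [hcont.continuousAt.eventually_lt_const hx] with z hz
    exact if_neg hz.not_gt
  · obtain rfl : x = 0 := by simpa [hγ] using hx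
    rw [if_neg hx.not_gt, ← hasDerivWithinAt_univ,
      show (univ : Set ℝ) = {z | 0 < z / γ} ∪ {z | ¬ 0 < z / γ} from (union_compl_self _).symm]
    refine HasDerivWithinAt.union ?_ ?_
    · rw [← hfg]
      exact (hF 0).hasDerivWithinAt.congr (fun z hz => if_pos hz) (by simp [hFG])
    · exact (hG 0).hasDerivWithinAt.congr (fun z hz => if_neg hz) (by simp)
  · rw [if_pos hx]
    refine (hF x).congr_of_eventuallyEq ?_
    filter_upwards [hcont.continuousAt.eventually_const_lt hx] with z hz
    exact if_pos hz

/-- The GAL density for `μ = 0`, `σ = 1`, up to its normalizing constant, on the side of the origin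
where `s / γ ≤ 0`. -/
noncomputable def galOuterPdf (γ P s : ℝ) : ℝ :=
  Phi (-|γ|) * exp (-(s * P) + γ ^ 2 / 2)

/-- The GAL density for `μ = 0`, `σ = 1`, up to its normalizing constant, on the side of the origin
where `0 ≤ s / γ`. -/
noncomputable def galInnerPdf (γ P M s : ℝ) : ℝ :=
  (Phi (-(s * P / |γ|) + M / P * |γ|) - Phi (M / P * |γ|)) *
      exp (-(s * M) + γ ^ 2 / 2 * (M / P) ^ 2) +
    Phi (-|γ| + s * P / |γ|) * exp (-(s * P) + γ ^ 2 / 2)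

/-- An antiderivative of `-2 * P * M * galOuterPdf γ P`. -/
noncomputable def galOuterCdf (γ P M s : ℝ) : ℝ :=
  2 * M * exp (-(s * P) + γ ^ 2 / 2) * Phi (-|γ|)

/-- An antiderivative of `-2 * P * M * galInnerPdf γ P M`. -/
noncomputable def galInnerCdf (γ P M s : ℝ) : ℝ :=
  (1 - 2 * Phi (s * P / γ) +
      2 * P * exp (-(s * M) + γ ^ 2 / 2 * (M / P) ^ 2) *
        (Phi (-(s * P / |γ|) + M / P * |γ|) - Phi (M / P * |γ|))) +
    2 * M * exp (-(s * P) + γ ^ 2 / 2) * Phi (-|γ| + s * P / |γ|)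

lemma galInnerPdf_zero (γ P M : ℝ) : galInnerPdf γ P M 0 = galOuterPdf γ P 0 := by
  simp [galInnerPdf, galOuterPdf]

lemma galInnerCdf_zero (γ P M : ℝ) : galInnerCdf γ P M 0 = galOuterCdf γ P M 0 := by
  simp [galInnerCdf, galOuterCdf, Phi_zero]

lemma hasDerivAt_exp_neg_mul_add (k c s : ℝ) :
    HasDerivAt (fun s => exp (-(s * k) + c)) (exp (-(s * k) + c) * -k) s := by
  have h : HasDerivAt (fun s => -(s * k) + c) (-k) s := by
    simpa using ((hasDerivAt_id s).mul_const k).neg.add_const c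
  exact h.exp

lemma hasDerivAt_galOuterCdf (γ P M s : ℝ) :
    HasDerivAt (galOuterCdf γ P M) (-2 * P * M * galOuterPdf γ P s) s := by
  unfold galOuterCdf galOuterPdf
  refine (((hasDerivAt_exp_neg_mul_add P (γ ^ 2 / 2) s).const_mul (2 * M)).mul_const
    (Phi (-|γ|))).congr_deriv ?_
  ring

lemma gaussianPDFReal_mul_exp {x y c : ℝ} (h : y ^ 2 / 2 = x ^ 2 / 2 - c) :
    exp c * gaussianPDFReal 0 1 x = gaussianPDFReal 0 1 y := by
  simp only [gaussianPDFReal, NNReal.coe_one, sub_zero, mul_one]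
  rw [mul_left_comm, ← exp_add]
  congr 2
  linarith

lemma hasDerivAt_galInnerCdf {γ P M : ℝ} (hγ : γ ≠ 0) (hP : P ≠ 0) (h : (M - P) * |γ| = γ)
    (s : ℝ) : HasDerivAt (galInnerCdf γ P M) (-2 * P * M * galInnerPdf γ P M s) s := by
  have ha : |γ| ≠ 0 := abs_ne_zero.2 hγ
  have hγa : γ ^ 2 = |γ| ^ 2 := (sq_abs γ).symm
  have hlin (k : ℝ) : HasDerivAt (fun s => s * P / k) (P / k) s := by
    simpa using ((hasDerivAt_id s).mul_const P).div_const k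
  have h₁ : HasDerivAt (fun s => Phi (s * P / γ)) _ s := (hasDerivAt_Phi _).comp s (hlin γ)
  have h₂ : HasDerivAt (fun s => Phi (-(s * P / |γ|) + M / P * |γ|)) _ s :=
    (hasDerivAt_Phi _).comp s ((hlin |γ|).neg.add_const _)
  have h₃ : HasDerivAt (fun s => Phi (-|γ| + s * P / |γ|)) _ s :=
    (hasDerivAt_Phi _).comp s ((hlin |γ|).const_add _)
  have e₂ := hasDerivAt_exp_neg_mul_add M (γ ^ 2 / 2 * (M / P) ^ 2) s
  have e₃ := hasDerivAt_exp_neg_mul_add P (γ ^ 2 / 2) s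
  have k₂ : exp (-(s * M) + γ ^ 2 / 2 * (M / P) ^ 2) *
      gaussianPDFReal 0 1 (-(s * P / |γ|) + M / P * |γ|) = gaussianPDFReal 0 1 (s * P / γ) := by
    apply gaussianPDFReal_mul_exp
    rw [div_pow (s * P) γ, hγa]
    field_simp
    ring
  have k₃ : exp (-(s * P) + γ ^ 2 / 2) * gaussianPDFReal 0 1 (-|γ| + s * P / |γ|) =
      gaussianPDFReal 0 1 (s * P / γ) := by
    apply gaussianPDFReal_mul_exp
    rw [div_pow (s * P) γ, hγa]
    field_simp
    ring
  have hsq : (M - P) ^ 2 = 1 := by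
    refine mul_right_cancel₀ (pow_ne_zero 2 ha) ?_
    rw [← mul_pow, h, one_mul, sq_abs]
  have hk : P / γ = (M - P) * (P / |γ|) := by
    rw [mul_div_assoc', div_eq_div_iff hγ ha]
    linear_combination (M - P) * P * h - P * |γ| * hsq
  unfold galInnerCdf galInnerPdf
  refine ((((h₁.const_mul 2).const_sub 1).add ((e₂.const_mul (2 * P)).mul (h₂.sub_const _))).add
    ((e₃.const_mul (2 * M)).mul h₃)).congr_deriv ?_
  rw [hk]
  linear_combination (-2 * P * (P / |γ|)) * k₂ + (2 * M * (P / |γ|)) * k₃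

lemma galOuterPdf_nonneg (γ P s : ℝ) : 0 ≤ galOuterPdf γ P s :=
  mul_nonneg (Phi_nonneg _) (exp_pos _).le

lemma galInnerPdf_nonneg {γ P M s : ℝ} (h : s * P ≤ 0) : 0 ≤ galInnerPdf γ P M s := by
  refine add_nonneg (mul_nonneg (sub_nonneg.2 (Phi_mono ?_)) (exp_pos _).le)
    (mul_nonneg (Phi_nonneg _) (exp_pos _).le)
  have := div_nonpos_of_nonpos_of_nonneg h (abs_nonneg γ)
  linarith

lemma tendsto_exp_neg_mul_add_atBot {k : ℝ} (hk : k < 0) (c : ℝ) :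
    Tendsto (fun s => exp (-(s * k) + c)) atBot (𝓝 0) := by
  refine tendsto_exp_atBot.comp (tendsto_atBot_add_const_right _ c ?_)
  simpa [mul_neg] using tendsto_id.atBot_mul_const (neg_pos.2 hk)

lemma tendsto_galOuterCdf_atBot (γ M : ℝ) {P : ℝ} (hP : P < 0) :
    Tendsto (galOuterCdf γ P M) atBot (𝓝 0) := by
  simpa [galOuterCdf] using! ((tendsto_exp_neg_mul_add_atBot hP (γ ^ 2 / 2)).const_mul (2 * M)).mul_const
    (Phi (-|γ|))

lemma tendsto_galInnerCdf_atBot {γ P M : ℝ} (hγ : γ < 0) (hP : 0 < P) (hM : M < 0) :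
    Tendsto (galInnerCdf γ P M) atBot (𝓝 (-1)) := by
  have ha : 0 < |γ| := abs_pos.2 hγ.ne
  have h₁ : Tendsto (fun s => Phi (s * P / γ)) atBot (𝓝 1) := by
    refine tendsto_Phi_atTop.comp ?_
    simp only [mul_div_assoc]
    exact tendsto_id.atBot_mul_const_of_neg (div_neg_of_pos_of_neg hP hγ)
  have h₂ : Tendsto (fun s => exp (-(s * M) + γ ^ 2 / 2 * (M / P) ^ 2) *
      (Phi (-(s * P / |γ|) + M / P * |γ|) - Phi (M / P * |γ|))) atBot (𝓝 0) := by
    refine (tendsto_exp_neg_mul_add_atBot hM _).zero_mul_isBoundedUnder_le ?_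
    refine isBoundedUnder_of ⟨1, fun s => ?_⟩
    have := Phi_nonneg (-(s * P / |γ|) + M / P * |γ|)
    have := Phi_le_one (-(s * P / |γ|) + M / P * |γ|)
    have := Phi_nonneg (M / P * |γ|)
    have := Phi_le_one (M / P * |γ|)
    simp only [Function.comp, norm_eq_abs, abs_le]
    constructor <;> linarith
  have h₃ : Tendsto (fun s => exp (-(s * P) + γ ^ 2 / 2) * Phi (-|γ| + s * P / |γ|))
      atBot (𝓝 0) := by
    have hlin : Tendsto (fun s => -|γ| + s * P / |γ|) atBot atBot := by
      refine tendsto_atBot_add_const_left _ _ ?_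
      simp only [mul_div_assoc]
      exact tendsto_id.atBot_mul_const (div_pos hP ha)
    have h := ((tendsto_exp_mul_Phi_atBot |γ|).comp hlin).const_mul (exp (-γ ^ 2 / 2))
    rw [mul_zero] at h
    refine h.congr fun s => ?_
    rw [Function.comp_apply, ← mul_assoc, ← exp_add, ← sq_abs γ]
    congr 2
    field_simp
    ring
  have h := (((h₁.const_mul 2).const_sub 1).add (h₂.const_mul (2 * P))).add (h₃.const_mul (2 * M))
  norm_num at h
  exact h.congr fun s => by simp only [galInnerCdf]; ring

/-- Integration of the quantile-fixed GAL density, where `E = 1{γ < 0}` and the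
parameters satisfy `P * γ < 0 < M * γ` and `M - P = sign γ`. -/
lemma integral_Iic_galPdf {γ P M E σ : ℝ} (μ : ℝ) (hσ : 0 < σ) (hPM : (M - P) * |γ| = γ)
    (h : 0 < γ ∧ P < 0 ∧ 0 < M ∧ E = 0 ∨ γ < 0 ∧ 0 < P ∧ M < 0 ∧ E = 1) (y : ℝ) :
    ∫ v in Iic y, -2 * P * M / σ *
        (if 0 < (v - μ) / σ / γ then galInnerPdf γ P M ((v - μ) / σ)
          else galOuterPdf γ P ((v - μ) / σ)) =
      E + if 0 < (y - μ) / σ / γ then galInnerCdf γ P M ((y - μ) / σ)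
        else galOuterCdf γ P M ((y - μ) / σ) := by
  have hγ : γ ≠ 0 := by rcases h with h | h <;> [exact h.1.ne'; exact h.1.ne]
  have hP : P ≠ 0 := by rcases h with h | h <;> [exact h.2.1.ne; exact h.2.1.ne']
  have hPM' : 0 ≤ -2 * P * M := by rcases h with h | h <;> nlinarith
  have hsub : Tendsto (fun v => (v - μ) / σ) atBot atBot :=
    (tendsto_atBot_add_const_right _ (-μ) tendsto_id).atBot_div_const hσ
  refine integral_Iic_of_hasDerivAt_of_nonneg
    (F := fun v => E + if 0 < (v - μ) / σ / γ then galInnerCdf γ P M ((v - μ) / σ)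
      else galOuterCdf γ P M ((v - μ) / σ)) (fun v => ?_) (fun v => ?_) ?_ y
  · have hd := hasDerivAt_ite_div_pos hγ (hasDerivAt_galInnerCdf hγ hP hPM)
      (hasDerivAt_galOuterCdf γ P M) (galInnerCdf_zero γ P M)
      (by rw [galInnerPdf_zero]) ((v - μ) / σ)
    have hs : HasDerivAt (fun v => (v - μ) / σ) (1 / σ) v :=
      ((hasDerivAt_id v).sub_const μ).div_const σ
    refine ((hd.comp v hs).const_add E).congr_deriv ?_
    split_ifs <;> ring
  · refine mul_nonneg (div_nonneg hPM' hσ.le) ?_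
    split_ifs with hv
    · refine galInnerPdf_nonneg ?_
      rcases h with ⟨hγ', hP', -⟩ | ⟨hγ', hP', -⟩
      · exact mul_nonpos_of_nonneg_of_nonpos ((div_pos_iff_of_pos_right hγ').1 hv).le hP'.le
      · have hs : (v - μ) / σ ≤ 0 :=
          le_of_not_gt fun h => (div_neg_of_pos_of_neg h hγ').not_gt hv
        exact mul_nonpos_of_nonpos_of_nonneg hs hP'.le
    · exact galOuterPdf_nonneg _ _ _
  · have hneg := hsub.eventually (eventually_lt_atBot 0)
    rcases h with ⟨hγ', hP', hM', rfl⟩ | ⟨hγ', hP', hM', rfl⟩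
    · refine ((tendsto_galOuterCdf_atBot γ M hP').comp hsub).congr' ?_
      filter_upwards [hneg] with v hv
      rw [if_neg (div_neg_of_neg_of_pos hv hγ').not_gt, zero_add, Function.comp_apply]
    · have hlim := ((tendsto_galInnerCdf_atBot hγ' hP' hM').comp hsub).const_add 1
      rw [add_neg_cancel] at hlim
      refine hlim.congr' ?_
      filter_upwards [hneg] with v hv
      rw [if_pos (div_pos_of_neg_of_neg hv hγ'), Function.comp_apply]

/-- The cumulative distribution function of the quantile-fixed GAL distribution. -/
theorem galQ_cdf (p₀ μ σ γ : ℝ) (hp₀ : p₀ ∈ Set.Ioo (0 : ℝ) 1) (hσ : 0 < σ)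
    (hγ : γ ≠ 0) (hγp : 0 < γ → p₀ < gFun γ) (hγn : γ < 0 → 1 - p₀ < gFun γ)
    (y : ℝ) :
    (∫ v in Set.Iic y, galQPdf p₀ μ σ γ v) =
      (let p := (if γ < 0 then 1 else 0) + (p₀ - (if γ < 0 then 1 else 0)) / gFun γ
       let pP := p - (if 0 < γ then 1 else 0)
       let pM := p - (if γ < 0 then 1 else 0)
       let ys := (y - μ) / σ
       (1 - 2 * Phi (ys * pP / γ) +
            2 * pP * Real.exp (-(ys * pM) + γ ^ 2 / 2 * (pM / pP) ^ 2) *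
              (Phi (-(ys * pP / |γ|) + pM / pP * |γ|) - Phi (pM / pP * |γ|))) *
          (if 0 < ys / γ then 1 else 0) +
        (if γ < 0 then 1 else 0) +
        2 * pM * Real.exp (-(ys * pP) + γ ^ 2 / 2) *
          Phi (-|γ| + ys * pP / |γ| * (if 0 < ys / γ then 1 else 0))) := by
  extract_lets p pP pM ys
  have hpM : -2 * pP * pM = 2 * p * (1 - p) := by
    rcases lt_or_gt_of_ne hγ with h | h <;> simp only [pP, pM, h, h.not_gt, if_true, if_false] <;>
      ring
  have hsign : (pM - pP) * |γ| = γ := by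
    rcases lt_or_gt_of_ne hγ with h | h
    · simp [pP, pM, h, h.not_gt, abs_of_neg h]
    · simp [pP, pM, h, h.not_gt, abs_of_pos h]
  have hcases : 0 < γ ∧ pP < 0 ∧ 0 < pM ∧ (if γ < 0 then (1 : ℝ) else 0) = 0 ∨
      γ < 0 ∧ 0 < pP ∧ pM < 0 ∧ (if γ < 0 then (1 : ℝ) else 0) = 1 := by
    rcases lt_or_gt_of_ne hγ with h | h
    · right
      have hg := hγn h
      have hg0 : 0 < gFun γ := (sub_pos.2 hp₀.2).trans hg
      have h1 : (1 - p₀) / gFun γ < 1 := (div_lt_one hg0).2 hg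
      have h2 : 0 < (1 - p₀) / gFun γ := div_pos (sub_pos.2 hp₀.2) hg0
      have hp : p = 1 - (1 - p₀) / gFun γ := by
        simp only [p, h, if_true]
        ring
      simp only [pP, pM, h, h.not_gt, if_true, if_false, hp]
      refine ⟨trivial, ?_, ?_, trivial⟩ <;> linarith
    · left
      have hg := hγp h
      have hg0 : 0 < gFun γ := hp₀.1.trans hg
      have h1 : p₀ / gFun γ < 1 := (div_lt_one hg0).2 hg
      have h2 : 0 < p₀ / gFun γ := div_pos hp₀.1 hg0
      have hp : p = p₀ / gFun γ := by simp [p, h.not_gt]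
      simp only [pP, pM, h, h.not_gt, if_true, if_false, hp]
      refine ⟨trivial, ?_, ?_, trivial⟩ <;> linarith
  have hcdf := integral_Iic_galPdf μ hσ hsign hcases y
  rw [hpM] at hcdf
  convert hcdf using 1
  · congr 1
    ext v
    simp only [galQPdf, galInnerPdf, galOuterPdf]
    split_ifs <;> simp [p, pP, pM, *]
  · simp only [galInnerCdf, galOuterCdf, ys]
    split_ifs <;> ring_nf
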